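/- Let |A| = |B| = 1 with 0 ∉ A, 0 ∉ B, Q = {q}, n ≥ 5, and suppose Γ = Γ_n(A,B,{q}) is properly given. Then Γ is connected and planar if and only if one of the following holds for some s: (i) {A,B} = {{s}, {±s mod n}} with gcd(n,s) = 1; (ii) {A,B} = {{s}, {±2s mod n}} with n even and gcd(n,s) = 1; (iii) {A,B} = {{s}, {n/2}} with s even and gcd(n/2, s) = 1 (and n ≡ 2 mod 4). -/

import Mathlib

/-- The circulant graph `circ_n(S)`: vertices `ZMod n`, with `i` adjacent to `i + s` for `s ∈ S`. -/
def circGraph (n : ℕ) (S : Finset ℕ) : SimpleGraph (ZMod n) :=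
  SimpleGraph.fromRel (fun i j => ∃ s ∈ S, j = i + (s : ZMod n))

/-- The graph `Γ_n(A,B,Q)` with vertices `v_i = Sum.inl i`, `v'_i = Sum.inr i`, and edges
`(v_i, v_{i+a})` for `a ∈ A`, `(v'_i, v'_{i+b})` for `b ∈ B`, `(v_i, v'_{i+q})` for `q ∈ Q`. -/
def Gamma (n : ℕ) (A B Q : Finset ℕ) : SimpleGraph (ZMod n ⊕ ZMod n) :=
  SimpleGraph.fromRel (fun x y =>
    match x, y with
    | Sum.inl i, Sum.inl j => ∃ a ∈ A, j = i + (a : ZMod n)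
    | Sum.inr i, Sum.inr j => ∃ b ∈ B, j = i + (b : ZMod n)
    | Sum.inl i, Sum.inr j => ∃ q ∈ Q, j = i + (q : ZMod n)
    | Sum.inr _, Sum.inl _ => False)

/-- `H` is a minor of `G`: there are disjoint connected branch sets in `G`, one for each
vertex of `H`, such that adjacent vertices of `H` have adjacent branch sets. -/
def SimpleGraph.IsMinorOf {W V : Type*} (H : SimpleGraph W) (G : SimpleGraph V) : Prop :=
  ∃ f : V → Option W,
    (∀ w : W, (G.induce {v | f v = some w}).Connected) ∧
    (∀ w₁ w₂ : W, H.Adj w₁ w₂ →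
      ∃ v₁ v₂, f v₁ = some w₁ ∧ f v₂ = some w₂ ∧ G.Adj v₁ v₂)

/-- A graph is planar iff it has no `K₅` minor and no `K_{3,3}` minor (Wagner's theorem). -/
def SimpleGraph.Planar {V : Type*} (G : SimpleGraph V) : Prop :=
  ¬ (⊤ : SimpleGraph (Fin 5)).IsMinorOf G ∧
  ¬ (completeBipartiteGraph (Fin 3) (Fin 3)).IsMinorOf G

/-- `Γ_n(A,B,Q)` is properly given: `a₁ ≢ ±a₂ (mod n)` for distinct `a₁, a₂ ∈ A`,
and similarly for `B`. -/
def ProperlyGiven (n : ℕ) (A B : Finset ℕ) : Prop :=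
  (∀ a₁ ∈ A, ∀ a₂ ∈ A, a₁ ≠ a₂ →
    (a₁ : ZMod n) ≠ (a₂ : ZMod n) ∧ (a₁ : ZMod n) ≠ -(a₂ : ZMod n)) ∧
  (∀ b₁ ∈ B, ∀ b₂ ∈ B, b₁ ≠ b₂ →
    (b₁ : ZMod n) ≠ (b₂ : ZMod n) ∧ (b₁ : ZMod n) ≠ -(b₂ : ZMod n))

/-- `circ_n(S)` is properly given: `s ≢ ±t (mod n)` for distinct `s, t ∈ S`. -/
def ProperlyGivenS (n : ℕ) (S : Finset ℕ) : Prop :=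
  ∀ s ∈ S, ∀ t ∈ S, s ≠ t →
    (s : ZMod n) ≠ (t : ZMod n) ∧ (s : ZMod n) ≠ -(t : ZMod n)

/-- A permutation is regular of order `n`: all its cycles have length exactly `n`
(for `n = 1` this means the identity). -/
def IsRegularOfOrder {α : Type*} (f : Equiv.Perm α) (n : ℕ) : Prop :=
  f ^ n = 1 ∧ ∀ x : α, ∀ k : ℕ, 0 < k → k < n → (f ^ k) x ≠ x

namespace SimpleGraph

variable {V V' W : Type*}

theorem reachable_induce_preimage {G : SimpleGraph V} {C : SimpleGraph V'} (π : V → V')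
    (hfib : ∀ u v, π u = π v → u = v ∨ G.Adj u v)
    (hadj : ∀ x y, C.Adj x y → ∃ u v, π u = x ∧ π v = y ∧ G.Adj u v)
    (S : Set V') (u v : V) (hu : π u ∈ S) (hv : π v ∈ S)
    (h : (C.induce S).Reachable ⟨π u, hu⟩ ⟨π v, hv⟩) :
    (G.induce (π ⁻¹' S)).Reachable ⟨u, hu⟩ ⟨v, hv⟩ := by
  have fib : ∀ (u v : V) (hu : π u ∈ S) (hv : π v ∈ S), π u = π v →
      (G.induce (π ⁻¹' S)).Reachable ⟨u, hu⟩ ⟨v, hv⟩ := by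
    intro u v hu hv huv
    rcases hfib u v huv with rfl | h
    · exact Reachable.refl _
    · exact Adj.reachable (by simpa using h)
  obtain ⟨w⟩ := h
  have key : ∀ (x y : S), (C.induce S).Walk x y → ∀ (u v : V) (hu : π u ∈ S) (hv : π v ∈ S),
      π u = x.1 → π v = y.1 → (G.induce (π ⁻¹' S)).Reachable ⟨u, hu⟩ ⟨v, hv⟩ := by
    intro x y w
    induction w with
    | nil => exact fun u v hu hv h₁ h₂ => fib u v hu hv (h₁.trans h₂.symm)
    | @cons x z y hxz _ ih =>
      intro u v hu hv h₁ h₂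
      obtain ⟨u', v', huc, hv', huv⟩ := hadj x.1 z.1 (by simpa using hxz)
      have hu'S : π u' ∈ S := huc ▸ x.2
      have hv'S : π v' ∈ S := hv' ▸ z.2
      refine (fib u u' hu hu'S (h₁.trans huc.symm)).trans (Reachable.trans ?_
        (ih v' v hv'S hv hv' h₂))
      exact Adj.reachable (by simpa using huv)
  exact key _ _ w u v hu hv rfl rfl

/-- Minors lift along a map whose fibres are cliques and which hits every adjacency. -/
theorem IsMinorOf.of_contraction {H : SimpleGraph W} {G : SimpleGraph V} {C : SimpleGraph V'}
    (π : V → V') (hsurj : Function.Surjective π)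
    (hfib : ∀ u v, π u = π v → u = v ∨ G.Adj u v)
    (hadj : ∀ x y, C.Adj x y → ∃ u v, π u = x ∧ π v = y ∧ G.Adj u v)
    (h : H.IsMinorOf C) : H.IsMinorOf G := by
  obtain ⟨f, hf, hH⟩ := h
  refine ⟨f ∘ π, fun w => ?_, fun w₁ w₂ hw => ?_⟩
  · have hw := hf w
    obtain ⟨x, hx⟩ := hw.nonempty
    obtain ⟨u, rfl⟩ := hsurj x
    have : Nonempty {v | (f ∘ π) v = some w} := ⟨⟨u, hx⟩⟩
    exact Connected.mk fun ⟨u, hu⟩ ⟨v, hv⟩ =>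
      reachable_induce_preimage π hfib hadj _ u v hu hv (hw.preconnected _ _)
  · obtain ⟨x, y, hx, hy, hxy⟩ := hH w₁ w₂ hw
    obtain ⟨u, v, rfl, rfl, huv⟩ := hadj x y hxy
    exact ⟨u, v, hx, hy, huv⟩

theorem Planar.of_contraction {G : SimpleGraph V} {C : SimpleGraph V'}
    (π : V → V') (hsurj : Function.Surjective π)
    (hfib : ∀ u v, π u = π v → u = v ∨ G.Adj u v)
    (hadj : ∀ x y, C.Adj x y → ∃ u v, π u = x ∧ π v = y ∧ G.Adj u v)
    (h : G.Planar) : C.Planar :=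
  ⟨fun h' => h.1 (h'.of_contraction π hsurj hfib hadj),
    fun h' => h.2 (h'.of_contraction π hsurj hfib hadj)⟩

/-- A minor given by labelling an injective sequence of vertices, such that every vertex that is
not the root of its branch set has an earlier neighbour with the same label. -/
theorem isMinorOf_of_labelling {H : SimpleGraph W} {G : SimpleGraph V} (n : ℕ) (p : ℕ → V)
    (hp : ∀ i < n, ∀ j < n, p i = p j → i = j) (h : ℕ → Option W) (root : W → ℕ)
    (hroot : ∀ w, root w < n ∧ h (root w) = some w)
    (hpar : ∀ w, ∀ k < n, h k = some w →
      k = root w ∨ ∃ k' < k, h k' = some w ∧ G.Adj (p k') (p k))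
    (hadj : ∀ w₁ w₂, H.Adj w₁ w₂ → ∃ k₁ < n, ∃ k₂ < n,
      h k₁ = some w₁ ∧ h k₂ = some w₂ ∧ (G.Adj (p k₁) (p k₂) ∨ G.Adj (p k₂) (p k₁))) :
    H.IsMinorOf G := by
  classical
  let f : V → Option W := fun v => if hv : ∃ k < n, p k = v then h hv.choose else none
  have hf : ∀ k < n, f (p k) = h k := by
    intro k hk
    have hv : ∃ k' < n, p k' = p k := ⟨k, hk, rfl⟩
    have : hv.choose = k := hp _ hv.choose_spec.1 _ hk hv.choose_spec.2
    simp only [f, dif_pos hv, this]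
  have hf' : ∀ v w, f v = some w → ∃ k < n, p k = v := by
    intro v w hv
    by_contra hne
    simp [f, dif_neg hne] at hv
  refine ⟨f, fun w => ?_, fun w₁ w₂ hw => ?_⟩
  · have hr : f (p (root w)) = some w := (hf _ (hroot w).1).trans (hroot w).2
    have key : ∀ k, ∀ (hk : k < n) (hkw : f (p k) = some w),
        (G.induce {v | f v = some w}).Reachable ⟨p k, hkw⟩ ⟨p (root w), hr⟩ := by
      intro k
      induction k using Nat.strong_induction_on with
      | _ k ih =>
        intro hk hkw
        rcases hpar w k hk ((hf k hk).symm.trans hkw) with h₁ | ⟨k', hk', h₂, h₃⟩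
        · subst h₁; exact Reachable.refl _
        · have hk'n := hk'.trans hk
          have hk'w : f (p k') = some w := (hf k' hk'n).trans h₂
          refine Reachable.trans (Adj.reachable ?_) (ih k' hk' hk'n hk'w)
          simpa using h₃.symm
    have : Nonempty {v | f v = some w} := ⟨⟨_, hr⟩⟩
    refine Connected.mk fun ⟨x, hx⟩ ⟨y, hy⟩ => ?_
    obtain ⟨i, hi, rfl⟩ := hf' x w hx
    obtain ⟨j, hj, rfl⟩ := hf' y w hy
    exact (key i hi hx).trans (key j hj hy).symm
  · obtain ⟨k₁, h₁, k₂, h₂, h₃, h₄, h₅⟩ := hadj w₁ w₂ hw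
    exact ⟨p k₁, p k₂, (hf _ h₁).trans h₃, (hf _ h₂).trans h₄, h₅.elim id Adj.symm⟩

theorem top_isMinorOf_of_labelling [LinearOrder W] {G : SimpleGraph V} (n : ℕ) (p : ℕ → V)
    (hp : ∀ i < n, ∀ j < n, p i = p j → i = j) (h : ℕ → Option W) (root : W → ℕ)
    (hroot : ∀ w, root w < n ∧ h (root w) = some w)
    (hpar : ∀ w, ∀ k < n, h k = some w →
      k = root w ∨ ∃ k' < k, h k' = some w ∧ G.Adj (p k') (p k))
    (hadj : ∀ w₁ w₂ : W, w₁ < w₂ → ∃ k₁ < n, ∃ k₂ < n,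
      h k₁ = some w₁ ∧ h k₂ = some w₂ ∧ (G.Adj (p k₁) (p k₂) ∨ G.Adj (p k₂) (p k₁))) :
    (⊤ : SimpleGraph W).IsMinorOf G := by
  refine isMinorOf_of_labelling n p hp h root hroot hpar fun w₁ w₂ hw => ?_
  rcases lt_or_gt_of_ne hw.ne with hlt | hlt
  · exact hadj w₁ w₂ hlt
  · obtain ⟨k₁, h₁, k₂, h₂, h₃, h₄, h₅⟩ := hadj w₂ w₁ hlt
    exact ⟨k₂, h₂, k₁, h₁, h₄, h₃, h₅.symm⟩

theorem completeBipartiteGraph_isMinorOf_of_labelling {W' : Type*} {G : SimpleGraph V} (n : ℕ)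
    (p : ℕ → V) (hp : ∀ i < n, ∀ j < n, p i = p j → i = j) (h : ℕ → Option (W ⊕ W'))
    (root : W ⊕ W' → ℕ) (hroot : ∀ w, root w < n ∧ h (root w) = some w)
    (hpar : ∀ w, ∀ k < n, h k = some w →
      k = root w ∨ ∃ k' < k, h k' = some w ∧ G.Adj (p k') (p k))
    (hadj : ∀ w₁ w₂, ∃ k₁ < n, ∃ k₂ < n, h k₁ = some (.inl w₁) ∧ h k₂ = some (.inr w₂) ∧
      (G.Adj (p k₁) (p k₂) ∨ G.Adj (p k₂) (p k₁))) :
    (completeBipartiteGraph W W').IsMinorOf G := by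
  refine isMinorOf_of_labelling n p hp h root hroot hpar fun w₁ w₂ hw => ?_
  rcases w₁ with w₁ | w₁ <;> rcases w₂ with w₂ | w₂ <;> simp at hw
  · exact hadj w₁ w₂
  · obtain ⟨k₁, h₁, k₂, h₂, h₃, h₄, h₅⟩ := hadj w₂ w₁
    exact ⟨k₂, h₂, k₁, h₁, h₄, h₃, h₅.symm⟩

/-- The graph on `ZMod n` with edges `(x, x + a)` and `(x, x + b)`. -/
def twoCirc {n : ℕ} (a b : ZMod n) : SimpleGraph (ZMod n) :=
  fromRel fun x y => y = x + a ∨ y = x + b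

theorem twoCirc_comm {n : ℕ} (a b : ZMod n) : twoCirc a b = twoCirc b a := by
  unfold twoCirc
  congr 1
  ext x y
  exact or_comm

theorem twoCirc_neg {n : ℕ} (a b : ZMod n) : twoCirc a (-b) = twoCirc a b := by
  ext x y
  have h₁ : y = x + -b ↔ x = y + b := by constructor <;> rintro rfl <;> ring
  have h₂ : x = y + -b ↔ y = x + b := by constructor <;> rintro rfl <;> ring
  simp only [twoCirc, fromRel_adj, h₁, h₂]
  tauto

theorem twoCirc_adj_left {n : ℕ} {a b x y : ZMod n} (ha : a ≠ 0) (h : y = x + a) :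
    (twoCirc a b).Adj x y := by
  subst h
  simp [twoCirc, ha]

theorem twoCirc_adj_right {n : ℕ} {a b x y : ZMod n} (hb : b ≠ 0) (h : y = x + b) :
    (twoCirc a b).Adj x y := by
  subst h
  simp [twoCirc, hb]

theorem natCast_mul_unit_injOn {n : ℕ} {u : ZMod n} (hu : IsUnit u) (i : ℕ) (hi : i < n)
    (j : ℕ) (hj : j < n) (h : (i : ZMod n) * u = j * u) : i = j := by
  have := hu.mul_left_injective h
  rw [ZMod.natCast_eq_natCast_iff'] at this
  rwa [Nat.mod_eq_of_lt hi, Nat.mod_eq_of_lt hj] at this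

theorem natCast_eq_of_eq_or {n i j : ℕ} (h : j = i ∨ j + n = i) : (j : ZMod n) = i := by
  rcases h with rfl | rfl <;> simp

theorem twoCirc_adj_unit_left {n : ℕ} {u b : ZMod n} (hu : u ≠ 0) (i j : ℕ)
    (h : j = i + 1 ∨ j + n = i + 1) : (twoCirc u b).Adj (i * u) (j * u) := by
  refine twoCirc_adj_left hu ?_
  rw [natCast_eq_of_eq_or h]
  push_cast
  ring

theorem twoCirc_adj_unit_right {n c : ℕ} {u : ZMod n} (hb : c * u ≠ 0) (i j : ℕ)
    (h : j = i + c ∨ j + n = i + c) : (twoCirc u (c * u)).Adj (i * u) (j * u) := by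
  refine twoCirc_adj_right hb ?_
  rw [natCast_eq_of_eq_or h]
  push_cast
  ring

/-- The square of an odd cycle is not planar. -/
theorem not_planar_twoCirc_two_mul {n : ℕ} (hn : 5 ≤ n) (hodd : n % 2 = 1) {u : ZMod n}
    (hu : IsUnit u) (h₁ : u ≠ 0) (h₂ : 2 * u ≠ 0) : ¬ (twoCirc u (2 * u)).Planar := by
  intro hpl
  apply hpl.1
  have one : ∀ i j : ℕ, j = i + 1 ∨ j + n = i + 1 →
      (twoCirc u (2 * u)).Adj (i * u) (j * u) := twoCirc_adj_unit_left h₁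
  have two : ∀ i j : ℕ, j = i + 2 ∨ j + n = i + 2 →
      (twoCirc u (2 * u)).Adj (i * u) (j * u) := twoCirc_adj_unit_right (c := 2) h₂
  refine top_isMinorOf_of_labelling n (fun k => (k : ZMod n) * u) (natCast_mul_unit_injOn hu)
    (fun k => some (if k = 0 then 0 else if k = 1 then 1 else if k = 2 then 2 else
      if k % 2 = 1 then 3 else 4)) ![0, 1, 2, 3, 4] ?_ ?_ ?_
  · intro w
    fin_cases w <;> simp <;> omega
  · intro w k hk hkw
    by_cases h5 : k < 5
    · left
      interval_cases k <;> simp at hkw <;> subst hkw <;> simp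
    · right
      refine ⟨k - 2, by omega, ?_, two _ _ (by omega)⟩
      rw [← hkw]
      congr 1
      have : (k - 2) % 2 = k % 2 := by omega
      simp only [this]
      split_ifs <;> first | rfl | omega
  · intro w₁ w₂ hw
    fin_cases w₁ <;> fin_cases w₂ <;> simp at hw
    · exact ⟨0, by omega, 1, by omega, by simp, by simp, .inl (one _ _ (.inl rfl))⟩
    · exact ⟨0, by omega, 2, by omega, by simp, by simp, .inl (two _ _ (.inl rfl))⟩
    · exact ⟨0, by omega, n - 2, by omega, by simp, by grind,
        .inr (two _ _ (by omega))⟩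
    · exact ⟨0, by omega, n - 1, by omega, by simp, by grind,
        .inr (one _ _ (by omega))⟩
    · exact ⟨1, by omega, 2, by omega, by simp, by simp, .inl (one _ _ (.inl rfl))⟩
    · exact ⟨1, by omega, 3, by omega, by simp, by simp, .inl (two _ _ (.inl rfl))⟩
    · exact ⟨1, by omega, n - 1, by omega, by simp, by grind,
        .inr (two _ _ (by omega))⟩
    · exact ⟨2, by omega, 3, by omega, by simp, by simp, .inl (one _ _ (.inl rfl))⟩
    · exact ⟨2, by omega, 4, by omega, by simp, by simp, .inl (two _ _ (.inl rfl))⟩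
    · exact ⟨3, by omega, 4, by omega, by simp, by simp, .inl (one _ _ (.inl rfl))⟩

end SimpleGraph

namespace SimpleGraph

theorem not_planar_twoCirc_natCast_mul {n c : ℕ} (hc : 3 ≤ c) (hn : 2 * c + 2 ≤ n) {u : ZMod n}
    (hu : IsUnit u) (h₁ : u ≠ 0) (h₂ : (c : ZMod n) * u ≠ 0) :
    ¬ (twoCirc u (c * u)).Planar := by
  intro hpl
  apply hpl.2
  have one : ∀ i j : ℕ, j = i + 1 ∨ j + n = i + 1 →
      (twoCirc u (c * u)).Adj (i * u) (j * u) := twoCirc_adj_unit_left h₁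
  have chord : ∀ i j : ℕ, j = i + c ∨ j + n = i + c →
      (twoCirc u (c * u)).Adj (i * u) (j * u) := twoCirc_adj_unit_right h₂
  refine completeBipartiteGraph_isMinorOf_of_labelling n (fun k => (k : ZMod n) * u)
    (natCast_mul_unit_injOn hu)
    (fun k => some (if k < c then .inl 0 else if k = c then .inr 1 else if k = c + 1 then .inl 1
      else if k < 2 * c then .inr 2 else if k = 2 * c then .inl 2 else .inr 0))
    (Sum.elim ![0, c + 1, 2 * c] ![2 * c + 1, c, c + 2]) ?_ ?_ ?_
  · rintro (w | w) <;> fin_cases w <;> simp <;> grind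
  · intro w k hk hkw
    by_cases hr : k = 0 ∨ k = c ∨ k = c + 1 ∨ k = c + 2 ∨ k = 2 * c ∨ k = 2 * c + 1
    · left
      rcases hr with rfl | rfl | rfl | rfl | rfl | rfl
      · obtain rfl : w = .inl 0 := by grind
        rfl
      · obtain rfl : w = .inr 1 := by grind
        rfl
      · obtain rfl : w = .inl 1 := by grind
        rfl
      · obtain rfl : w = .inr 2 := by grind
        rfl
      · obtain rfl : w = .inl 2 := by grind
        rfl
      · obtain rfl : w = .inr 0 := by grind
        rfl
    · right
      refine ⟨k - 1, by omega, ?_, one _ _ (by omega)⟩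
      rw [← hkw]
      grind
  · intro w₁ w₂
    fin_cases w₁ <;> fin_cases w₂
    · exact ⟨0, by omega, n - 1, by omega, by grind, by grind, .inr (one _ _ (by omega))⟩
    · exact ⟨0, by omega, c, by omega, by grind, by grind, .inl (chord _ _ (by omega))⟩
    · exact ⟨2, by omega, c + 2, by omega, by grind, by grind, .inl (chord _ _ (by omega))⟩
    · exact ⟨c + 1, by omega, 2 * c + 1, by omega, by grind, by grind,
        .inl (chord _ _ (by omega))⟩
    · exact ⟨c + 1, by omega, c, by omega, by grind, by grind, .inr (one _ _ (by omega))⟩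
    · exact ⟨c + 1, by omega, c + 2, by omega, by grind, by grind, .inl (one _ _ (by omega))⟩
    · exact ⟨2 * c, by omega, 2 * c + 1, by omega, by grind, by grind,
        .inl (one _ _ (by omega))⟩
    · exact ⟨2 * c, by omega, c, by omega, by grind, by grind, .inr (chord _ _ (by omega))⟩
    · exact ⟨2 * c, by omega, 2 * c - 1, by omega, by grind, by grind,
        .inr (one _ _ (by omega))⟩

/-- Möbius ladders with at least three rungs are not planar. -/
theorem not_planar_twoCirc_half {n m : ℕ} (hm : 3 ≤ m) (hn : n = 2 * m) {u : ZMod n}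
    (hu : IsUnit u) (h₁ : u ≠ 0) (h₂ : (m : ZMod n) * u ≠ 0) :
    ¬ (twoCirc u (m * u)).Planar := by
  intro hpl
  apply hpl.2
  have one : ∀ i j : ℕ, j = i + 1 ∨ j + n = i + 1 →
      (twoCirc u (m * u)).Adj (i * u) (j * u) := twoCirc_adj_unit_left h₁
  have chord : ∀ i j : ℕ, j = i + m ∨ j + n = i + m →
      (twoCirc u (m * u)).Adj (i * u) (j * u) := twoCirc_adj_unit_right h₂
  refine completeBipartiteGraph_isMinorOf_of_labelling n (fun k => (k : ZMod n) * u)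
    (natCast_mul_unit_injOn hu)
    (fun k => some (if k = 0 then .inl 0 else if k = 1 then .inr 0 else if k < m then .inl 1
      else if k = m then .inr 1 else if k = m + 1 then .inl 2 else .inr 2))
    (Sum.elim ![0, 2, m + 1] ![1, m, m + 2]) ?_ ?_ ?_
  · rintro (w | w) <;> fin_cases w <;> simp <;> grind
  · intro w k hk hkw
    by_cases hr : k = 0 ∨ k = 1 ∨ k = 2 ∨ k = m ∨ k = m + 1 ∨ k = m + 2
    · left
      rcases hr with rfl | rfl | rfl | rfl | rfl | rfl
      · obtain rfl : w = .inl 0 := by grind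
        rfl
      · obtain rfl : w = .inr 0 := by grind
        rfl
      · obtain rfl : w = .inl 1 := by grind
        rfl
      · obtain rfl : w = .inr 1 := by grind
        rfl
      · obtain rfl : w = .inl 2 := by grind
        rfl
      · obtain rfl : w = .inr 2 := by grind
        rfl
    · right
      refine ⟨k - 1, by omega, ?_, one _ _ (by omega)⟩
      rw [← hkw]
      grind
  · intro w₁ w₂
    fin_cases w₁ <;> fin_cases w₂
    · exact ⟨0, by omega, 1, by omega, by grind, by grind, .inl (one _ _ (by omega))⟩
    · exact ⟨0, by omega, m, by omega, by grind, by grind, .inl (chord _ _ (by omega))⟩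
    · exact ⟨0, by omega, n - 1, by omega, by grind, by grind, .inr (one _ _ (by omega))⟩
    · exact ⟨2, by omega, 1, by omega, by grind, by grind, .inr (one _ _ (by omega))⟩
    · exact ⟨m - 1, by omega, m, by omega, by grind, by grind, .inl (one _ _ (by omega))⟩
    · exact ⟨2, by omega, m + 2, by omega, by grind, by grind, .inl (chord _ _ (by omega))⟩
    · exact ⟨m + 1, by omega, 1, by omega, by grind, by grind, .inr (chord _ _ (by omega))⟩
    · exact ⟨m + 1, by omega, m, by omega, by grind, by grind, .inr (one _ _ (by omega))⟩
    · exact ⟨m + 1, by omega, m + 2, by omega, by grind, by grind, .inl (one _ _ (by omega))⟩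

/-- A cylinder made of `d ≥ 3` cycles of length `L ≥ 3`, with an edge from the last cycle to the
first one, is not planar: its first cycle, the last `d - 2` cycles, and three arcs of the second
cycle form a `K₅`. -/
theorem not_planar_of_grid {V : Type*} {G : SimpleGraph V} {n L d : ℕ} (hL3 : 3 ≤ L) (hd : 3 ≤ d)
    (hL : n = L * d) (p : ℕ → V) (hinj : ∀ i < n, ∀ j < n, p i = p j → i = j)
    (stepa : ∀ i, (i + 1) % L ≠ 0 → G.Adj (p i) (p (i + 1)))
    (stepb : ∀ i, G.Adj (p i) (p (i + L))) (ring_closes : G.Adj (p (2 * L - 1)) (p L))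
    (hlast : ∃ k < L, G.Adj (p (L * (d - 1))) (p k)) : ¬ G.Planar := by
  intro hpl
  apply hpl.1
  obtain ⟨k₀, hk₀, hlast⟩ := hlast
  have hn3 : L * 3 ≤ n := by rw [hL]; exact Nat.mul_le_mul_left _ hd
  have hlast_le : 2 * L ≤ L * (d - 1) := by
    rw [mul_comm]; exact Nat.mul_le_mul_left _ (by omega)
  have hlast_lt : L * (d - 1) < n := by
    rw [hL]; exact Nat.mul_lt_mul_of_pos_left (by omega) (by omega)
  refine top_isMinorOf_of_labelling n p hinj
    (fun k => some (if k < L then 0 else if k = L then 1 else if k = L + 1 then 2 else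
      if k < 2 * L then 3 else 4)) ![0, L, L + 1, L + 2, 2 * L] ?_ ?_ ?_
  · intro w
    fin_cases w <;> simp <;> grind
  · intro w k hk hkw
    by_cases hr : k = 0 ∨ k = L ∨ k = L + 1 ∨ k = L + 2 ∨ k = 2 * L
    · left
      rcases hr with rfl | rfl | rfl | rfl | rfl
      · obtain rfl : w = 0 := by grind
        rfl
      · obtain rfl : w = 1 := by grind
        rfl
      · obtain rfl : w = 2 := by grind
        rfl
      · obtain rfl : w = 3 := by grind
        rfl
      · obtain rfl : w = 4 := by grind
        rfl
    · right
      by_cases hkL : k % L = 0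
      · have hk3 : 3 * L ≤ k := by
          obtain ⟨t, rfl⟩ := Nat.dvd_of_mod_eq_zero hkL
          have : 3 ≤ t := by
            by_contra hlt
            have : t = 0 ∨ t = 1 ∨ t = 2 := by omega
            rcases this with rfl | rfl | rfl <;> omega
          rw [mul_comm]
          exact Nat.mul_le_mul_left _ this
        refine ⟨k - L, by omega, ?_, ?_⟩
        · rw [← hkw]
          grind
        · have := stepb (k - L)
          rwa [show k - L + L = k by omega] at this
      · refine ⟨k - 1, by omega, ?_, ?_⟩
        · rw [← hkw]
          grind
        · have := stepa (k - 1)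
          rw [show k - 1 + 1 = k by omega] at this
          exact this hkL
  · intro w₁ w₂ hw
    have mod₁ : (L + 1) % L ≠ 0 := by
      rw [Nat.add_mod_left, Nat.mod_eq_of_lt (by omega)]; omega
    have mod₂ : (L + 1 + 1) % L ≠ 0 := by
      rw [add_assoc, Nat.add_mod_left, Nat.mod_eq_of_lt (by omega)]; omega
    fin_cases w₁ <;> fin_cases w₂ <;> simp at hw
    · exact ⟨0, by omega, 0 + L, by omega, by grind, by grind, .inl (stepb _)⟩
    · exact ⟨1, by omega, 1 + L, by omega, by grind, by grind, .inl (stepb _)⟩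
    · exact ⟨2, by omega, 2 + L, by omega, by grind, by grind, .inl (stepb _)⟩
    · exact ⟨k₀, by omega, L * (d - 1), by omega, by grind, by grind, .inr hlast⟩
    · exact ⟨L, by omega, L + 1, by omega, by grind, by grind, .inl (stepa _ mod₁)⟩
    · exact ⟨L, by omega, 2 * L - 1, by omega, by grind, by grind, .inr ring_closes⟩
    · exact ⟨L, by omega, L + L, by omega, by grind, by grind, .inl (stepb _)⟩
    · exact ⟨L + 1, by omega, L + 1 + 1, by omega, by grind, by grind, .inl (stepa _ mod₂)⟩
    · exact ⟨L + 1, by omega, L + 1 + L, by omega, by grind, by grind, .inl (stepb _)⟩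
    · exact ⟨L + 2, by omega, L + 2 + L, by omega, by grind, by grind, .inl (stepb _)⟩

/-- If `a` has at least three cosets, each with at least three elements, then a connected
`twoCirc a b` is not planar. -/
theorem not_planar_twoCirc_of_three_le_gcd {n : ℕ} (hn : 0 < n) (a b : ℕ)
    (hd : 3 ≤ n.gcd a) (hcop : (n.gcd a).gcd b = 1) (ha : (a : ZMod n) ≠ 0)
    (hb : (b : ZMod n) ≠ 0) (h2a : 2 * (a : ZMod n) ≠ 0) :
    ¬ (twoCirc (a : ZMod n) b).Planar := by
  obtain ⟨L, hL⟩ := n.gcd_dvd_left a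
  obtain ⟨a₁, ha₁⟩ := n.gcd_dvd_right a
  set d := n.gcd a with hdd
  have hLa : (L : ZMod n) * a = 0 := by
    rw [← Nat.cast_mul, ZMod.natCast_eq_zero_iff]
    exact ⟨a₁, by rw [ha₁]; conv_rhs => rw [hL]
                  ring⟩
  have hL3 : 3 ≤ L := by
    by_contra hlt
    have : L = 0 ∨ L = 1 ∨ L = 2 := by omega
    rcases this with rfl | rfl | rfl
    · omega
    · exact ha (by simpa using hLa)
    · exact h2a (by simpa using hLa)
  have hLpos : 0 < L := by omega
  have hcopL : L.Coprime a₁ := by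
    have h := Nat.coprime_div_gcd_div_gcd (m := n) (n := a) (by omega)
    rw [← hdd] at h
    rwa [show n / d = L by rw [hL]; exact Nat.mul_div_cancel_left _ (by omega),
      show a / d = a₁ by rw [ha₁]; exact Nat.mul_div_cancel_left _ (by omega)] at h
  set p : ℕ → ZMod n := fun k => ((k / L : ℕ) : ZMod n) * b + ((k % L : ℕ) : ZMod n) * a with hp
  have pval : ∀ j k, k < L → p (L * j + k) = j * b + k * a := by
    intro j k hk
    simp only [hp]
    rw [Nat.mul_add_div hLpos, Nat.div_eq_of_lt hk, Nat.mul_add_mod, Nat.mod_eq_of_lt hk]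
    simp
  have stepa : ∀ i, (i + 1) % L ≠ 0 → (twoCirc (a : ZMod n) b).Adj (p i) (p (i + 1)) := by
    intro i hi
    have hi' := Nat.div_add_mod i L
    have hlt := Nat.mod_lt i hLpos
    have hlt' : i % L + 1 < L := by
      by_contra hge
      apply hi
      have : i + 1 = L * (i / L + 1) := by rw [mul_add]; omega
      rw [this]
      exact Nat.mul_mod_right _ _
    rw [← hi', add_assoc, pval _ _ hlt, pval _ _ hlt']
    exact twoCirc_adj_left ha (by push_cast; ring)
  have stepb : ∀ i, (twoCirc (a : ZMod n) b).Adj (p i) (p (i + L)) := by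
    intro i
    refine twoCirc_adj_right hb ?_
    simp only [hp]
    rw [Nat.add_div_right _ hLpos, Nat.add_mod_right]
    push_cast
    ring
  have ring_closes : (twoCirc (a : ZMod n) b).Adj (p (2 * L - 1)) (p L) := by
    refine twoCirc_adj_left ha ?_
    have h₁ := pval 1 0 hLpos
    have h₂ := pval 1 (L - 1) (by omega)
    rw [show L * 1 + (L - 1) = 2 * L - 1 by omega] at h₂
    rw [show L * 1 + 0 = L by omega] at h₁
    rw [h₁, h₂, Nat.cast_sub (by omega)]
    push_cast
    linear_combination -hLa
  have hlast : ∃ k < L, (twoCirc (a : ZMod n) b).Adj (p (L * (d - 1))) (p k) := by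
    have hbez := Nat.gcd_eq_gcd_ab n a
    rw [← hdd] at hbez
    have hbez' : (d : ZMod n) = a * (n.gcdB a : ZMod n) := by
      have := congrArg (Int.cast (R := ZMod n)) hbez
      push_cast at this
      simpa using this
    have hLz : (0 : ℤ) < L := by exact_mod_cast hLpos
    have h0 := Int.emod_nonneg (n.gcdB a * b) hLz.ne'
    obtain ⟨k, hk⟩ := Int.eq_ofNat_of_zero_le h0
    have hlt : k < L := by
      have := Int.emod_lt_of_pos (n.gcdB a * b) hLz
      omega
    refine ⟨k, hlt, twoCirc_adj_right hb ?_⟩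
    have h₁ := pval (d - 1) 0 hLpos
    have h₂ := pval 0 k hlt
    rw [add_zero] at h₁
    rw [mul_zero, zero_add] at h₂
    have hk' := Int.emod_add_mul_ediv (n.gcdB a * b) L
    rw [hk] at hk'
    have hk'' := congrArg (Int.cast (R := ZMod n)) hk'
    push_cast at hk''
    rw [h₁, h₂, Nat.cast_sub (by omega)]
    push_cast
    linear_combination (a : ZMod n) * hk'' - (b : ZMod n) * hbez' -
      hLa * ((n.gcdB a * b / L : ℤ) : ZMod n)
  have hinj : ∀ i < n, ∀ j < n, p i = p j → i = j := by
    intro i hi j hj hij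
    have hi' := Nat.div_add_mod i L
    have hj' := Nat.div_add_mod j L
    have hid : i / L < d := by
      rw [Nat.div_lt_iff_lt_mul hLpos, ← hL]; exact hi
    have hjd : j / L < d := by
      rw [Nat.div_lt_iff_lt_mul hLpos, ← hL]; exact hj
    have hmod : (i / L * b + i % L * a) ≡ (j / L * b + j % L * a) [MOD n] := by
      rw [← ZMod.natCast_eq_natCast_iff]
      push_cast
      exact hij
    have hdiv : i / L = j / L := by
      have h₁ := hmod.of_dvd (n.gcd_dvd_left a)
      rw [← hdd] at h₁
      have h₂ : ∀ x y, x * b + y * a ≡ x * b [MOD d] := by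
        intro x y
        have : y * a ≡ 0 [MOD d] := (Nat.modEq_zero_iff_dvd).2 (Dvd.dvd.mul_left ⟨a₁, ha₁⟩ _)
        simpa using Nat.ModEq.add_left (x * b) this
      have h₃ := ((h₂ _ _).symm.trans h₁).trans (h₂ _ _)
      have h₄ := Nat.ModEq.cancel_right_of_coprime hcop h₃
      exact Nat.ModEq.eq_of_lt_of_lt h₄ hid hjd
    have hmd : i % L = j % L := by
      rw [hdiv] at hmod
      have h₁ := Nat.ModEq.add_left_cancel' _ hmod
      rw [ha₁, hL] at h₁
      have h₂ : d * (i % L * a₁) ≡ d * (j % L * a₁) [MOD d * L] := by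
        convert h₁ using 1 <;> ring
      have h₃ := Nat.ModEq.mul_left_cancel' (by omega) h₂
      have h₄ := Nat.ModEq.cancel_right_of_coprime hcopL h₃
      exact Nat.ModEq.eq_of_lt_of_lt h₄ (Nat.mod_lt _ hLpos) (Nat.mod_lt _ hLpos)
    rw [← hi', ← hj', hdiv, hmd]
  exact not_planar_of_grid hL3 hd (hL.trans (mul_comm _ _)) p hinj stepa stepb ring_closes hlast

end SimpleGraph

section Duality

variable {V W E K F : Type*}

/-- The boundary modulo 2 of a chain on a multigraph whose edge `e` joins `s e` and `t e`. -/
def boundary [Fintype E] [DecidableEq V] (s t : E → V) (z : E → ZMod 2) (v : V) : ZMod 2 :=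
  ∑ e, z e * ((if s e = v then 1 else 0) + (if t e = v then 1 else 0))

/-- The multigraph with edges `(l e, r e)` is an algebraic dual of the one with edges
`(s e, t e)`: the cycles modulo 2 of the latter are the cuts of the former. -/
def IsAlgebraicDual [Fintype E] [DecidableEq V] (s t : E → V) (l r : E → F) : Prop :=
  ∀ z : E → ZMod 2, (∀ v, boundary s t z v = 0) ↔ ∃ x : F → ZMod 2, ∀ e, z e = x (l e) + x (r e)

theorem boundary_add [Fintype E] [DecidableEq V] (s t : E → V) (z z' : E → ZMod 2) (v : V) :
    boundary s t (z + z') v = boundary s t z v + boundary s t z' v := by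
  simp [boundary, add_mul, Finset.sum_add_distrib]

theorem boundary_single [Fintype E] [DecidableEq E] [DecidableEq V] (s t : E → V) (e : E) (v : V) :
    boundary s t (Pi.single e 1) v = (if s e = v then 1 else 0) + (if t e = v then 1 else 0) := by
  simp [boundary, Pi.single_apply]

theorem boundary_sum_smul [Fintype E] [DecidableEq V] [Fintype K] (s t : E → V) (c : K → ZMod 2)
    (z : K → E → ZMod 2) (v : V) :
    boundary s t (fun e => ∑ k, c k * z k e) v = ∑ k, c k * boundary s t (z k) v := by
  simp only [boundary, Finset.sum_mul, Finset.mul_sum]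
  rw [Finset.sum_comm]
  simp only [mul_assoc]

/-- In a connected induced subgraph, any two vertices are joined by a chain of edges. -/
theorem exists_chain_of_reachable [Fintype E] [DecidableEq V] {G : SimpleGraph V} (s t : E → V)
    (hG : ∀ u v, G.Adj u v → ∃ e, (s e = u ∧ t e = v) ∨ (s e = v ∧ t e = u)) (S : Set V)
    (x y : S) (h : (G.induce S).Reachable x y) :
    ∃ z : E → ZMod 2, (∀ e, z e ≠ 0 → s e ∈ S ∧ t e ∈ S) ∧
      ∀ v, boundary s t z v = (if x.1 = v then 1 else 0) + (if y.1 = v then 1 else 0) := by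
  classical
  obtain ⟨p⟩ := h
  induction p with
  | nil => exact ⟨0, by simp, fun v => by simp [boundary, CharTwo.add_self_eq_zero]⟩
  | @cons x w y hxw _ ih =>
    obtain ⟨z, hz, hb⟩ := ih
    obtain ⟨e, he⟩ := hG x.1 w.1 (by simpa using hxw)
    refine ⟨z + Pi.single e 1, fun e' he' => ?_, fun v => ?_⟩
    · by_cases hee : e' = e
      · subst hee
        rcases he with ⟨h₁, h₂⟩ | ⟨h₁, h₂⟩ <;> rw [h₁, h₂]
        · exact ⟨x.2, w.2⟩
        · exact ⟨w.2, x.2⟩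
      · exact hz e' (by simpa [hee] using he')
    · rw [boundary_add, boundary_single, hb]
      have h2 := CharTwo.add_self_eq_zero (if w.1 = v then (1 : ZMod 2) else 0)
      rcases he with ⟨h₁, h₂⟩ | ⟨h₁, h₂⟩ <;> rw [h₁, h₂] <;> linear_combination h2

/-- Algebraic duals are inherited by minors. -/
theorem SimpleGraph.IsMinorOf.exists_isAlgebraicDual [Finite V] [DecidableEq V] [Fintype E]
    [Finite F] [DecidableEq W] [Fintype K] {H : SimpleGraph W} {G : SimpleGraph V}
    (hHG : H.IsMinorOf G) (s t : E → V) (l r : E → F)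
    (hG : ∀ u v, G.Adj u v → ∃ e, (s e = u ∧ t e = v) ∨ (s e = v ∧ t e = u))
    (hdual : IsAlgebraicDual s t l r) (p q : K → W) (hpq : ∀ k, H.Adj (p k) (q k))
    (hinj : Function.Injective fun k => s(p k, q k)) :
    ∃ (F' : Type) (_ : Finite F') (l' r' : K → F'), IsAlgebraicDual p q l' r' := by
  classical
  have := Fintype.ofFinite V
  obtain ⟨f, hconn, hadj⟩ := hHG
  have hedge : ∀ k, ∃ e, s(f (s e), f (t e)) = s(some (p k), some (q k)) := by
    intro k
    obtain ⟨u, v, hu, hv, huv⟩ := hadj _ _ (hpq k)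
    obtain ⟨e, ⟨h₁, h₂⟩ | ⟨h₁, h₂⟩⟩ := hG u v huv
    · exact ⟨e, by rw [h₁, h₂, hu, hv]⟩
    · exact ⟨e, by rw [h₁, h₂, hu, hv, Sym2.eq_swap]⟩
  choose ε hε using hedge
  have εinj : Function.Injective ε := by
    intro k k' h
    apply hinj
    have h' : s(some (p k), some (q k)) = s(some (p k'), some (q k')) := by
      rw [← hε k, ← hε k', h]
    simpa using h'
  have εne : ∀ k, f (s (ε k)) ≠ f (t (ε k)) := by
    intro k h
    have := hε k
    rw [h] at this
    have hne := (hpq k).ne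
    grind
  let deleted : E → Prop := fun e =>
    (∀ k, ε k ≠ e) ∧ ¬ ∃ w, f (s e) = some w ∧ f (t e) = some w
  let R : F → F → Prop := fun φ ψ => ∃ e, deleted e ∧ φ = l e ∧ ψ = r e
  have hroot : ∀ w, ∃ v, f v = some w := fun w => by
    obtain ⟨v, hv⟩ := (hconn w).nonempty
    exact ⟨v, hv⟩
  choose ρ hρ using hroot
  have hchain : ∀ k, ∃ z : E → ZMod 2, (∀ e, deleted e → z e = 0) ∧
      (∀ k', z (ε k') = if k' = k then 1 else 0) ∧
      ∀ v, boundary s t z v = (if ρ (p k) = v then 1 else 0) + (if ρ (q k) = v then 1 else 0) := by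
    intro k
    have tree : ∀ v w, f v = some w → ∃ z : E → ZMod 2,
        (∀ e, z e ≠ 0 → f (s e) = some w ∧ f (t e) = some w) ∧
        ∀ v', boundary s t z v' = (if v = v' then 1 else 0) + (if ρ w = v' then 1 else 0) := by
      intro v w hv
      exact exists_chain_of_reachable s t hG {v | f v = some w} ⟨v, hv⟩ ⟨ρ w, hρ w⟩
        ((hconn w).preconnected _ _)
    have vanish : ∀ (z : E → ZMod 2) w,
        (∀ e, z e ≠ 0 → f (s e) = some w ∧ f (t e) = some w) →
        (∀ e, deleted e → z e = 0) ∧ ∀ k', z (ε k') = 0 := by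
      intro z w hz
      refine ⟨fun e he => ?_, fun k' => ?_⟩
      · by_contra hne
        exact he.2 ⟨w, hz e hne⟩
      · by_contra hne
        have := hz _ hne
        exact εne k' (this.1.trans this.2.symm)
    have main : ∀ w₁ w₂, f (s (ε k)) = some w₁ → f (t (ε k)) = some w₂ →
        ∃ z : E → ZMod 2, (∀ e, deleted e → z e = 0) ∧
        (∀ k', z (ε k') = if k' = k then 1 else 0) ∧
        ∀ v, boundary s t z v = (if ρ w₁ = v then 1 else 0) + (if ρ w₂ = v then 1 else 0) := by
      intro w₁ w₂ h₁ h₂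
      obtain ⟨z₁, hz₁, hb₁⟩ := tree _ _ h₁
      obtain ⟨z₂, hz₂, hb₂⟩ := tree _ _ h₂
      obtain ⟨hd₁, hk₁⟩ := vanish z₁ _ hz₁
      obtain ⟨hd₂, hk₂⟩ := vanish z₂ _ hz₂
      refine ⟨Pi.single (ε k) 1 + (z₁ + z₂), fun e he => ?_, fun k' => ?_, fun v => ?_⟩
      · have : e ≠ ε k := fun h => he.1 k h.symm
        simp [hd₁ e he, hd₂ e he, this]
      · simp [hk₁, hk₂, Pi.single_apply, εinj.eq_iff]
      · rw [boundary_add, boundary_add, boundary_single, hb₁, hb₂]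
        have h₃ := CharTwo.add_self_eq_zero (if s (ε k) = v then (1 : ZMod 2) else 0)
        have h₄ := CharTwo.add_self_eq_zero (if t (ε k) = v then (1 : ZMod 2) else 0)
        linear_combination h₃ + h₄
    rcases Sym2.eq_iff.1 (hε k) with ⟨h₁, h₂⟩ | ⟨h₁, h₂⟩
    · exact main _ _ h₁ h₂
    · obtain ⟨z, hz₁, hz₂, hz₃⟩ := main _ _ h₁ h₂
      exact ⟨z, hz₁, hz₂, fun v => (hz₃ v).trans (add_comm _ _)⟩
  choose Z hZd hZk hZb using hchain
  have key : IsAlgebraicDual p q (fun k => Quot.mk R (l (ε k))) (fun k => Quot.mk R (r (ε k))) := by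
    intro c
    constructor
    · intro hc
      obtain ⟨x, hx⟩ := (hdual fun e => ∑ k, c k * Z k e).1 fun v => by
        rw [boundary_sum_smul]
        simp only [hZb]
        have : ∀ w, ∑ k, c k * ((if p k = w then if ρ w = v then 1 else 0 else 0) +
            (if q k = w then if ρ w = v then 1 else 0 else 0)) = 0 := by
          intro w
          have h := hc w
          unfold boundary at h
          by_cases hw : ρ w = v
          · simpa [hw] using h
          · simp [hw]
        by_cases hv : ∃ w, f v = some w
        · obtain ⟨w, hw⟩ := hv
          refine Eq.trans ?_ (this w)
          have hρw : ∀ w', ρ w' = v → w' = w := by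
            intro w' h
            have := hρ w'
            rw [h, hw] at this
            exact (Option.some.inj this).symm
          refine Finset.sum_congr rfl fun k _ => ?_
          congr 2 <;> grind
        · have hρw : ∀ w', ρ w' ≠ v := fun w' h => hv ⟨w', h ▸ hρ w'⟩
          simp [hρw]
      refine ⟨Quot.lift x ?_, fun k => ?_⟩
      · rintro _ _ ⟨e, he, rfl, rfl⟩
        have := hx e
        simp only [hZd _ e he, mul_zero, Finset.sum_const_zero] at this
        exact CharTwo.add_eq_zero.1 this.symm
      · have := hx (ε k)
        simp only [hZk] at this
        simpa using this
    · rintro ⟨x, hx⟩ w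
      have hz := (hdual fun e => x (Quot.mk R (l e)) + x (Quot.mk R (r e))).2
        ⟨fun φ => x (Quot.mk R φ), fun _ => rfl⟩
      have hsum : ∑ v with f v = some w, boundary s t
          (fun e => x (Quot.mk R (l e)) + x (Quot.mk R (r e))) v = 0 :=
        Finset.sum_eq_zero fun v _ => hz v
      simp only [boundary] at hsum
      rw [Finset.sum_comm] at hsum
      have hsum' : ∑ e, (x (Quot.mk R (l e)) + x (Quot.mk R (r e))) *
          ((if f (s e) = some w then 1 else 0) + (if f (t e) = some w then 1 else 0)) = 0 := by
        refine Eq.trans ?_ hsum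
        refine Finset.sum_congr rfl fun e _ => ?_
        rw [← Finset.mul_sum, Finset.sum_add_distrib]
        simp
      rw [← hsum']
      unfold boundary
      have himg : ∀ e ∈ Finset.univ, e ∉ Finset.univ.image ε →
          (x (Quot.mk R (l e)) + x (Quot.mk R (r e))) *
          ((if f (s e) = some w then 1 else 0) + (if f (t e) = some w then 1 else 0)) = 0 := by
        intro e _ he
        by_cases hd : deleted e
        · have : Quot.mk R (l e) = Quot.mk R (r e) := Quot.sound ⟨e, hd, rfl, rfl⟩
          rw [this, CharTwo.add_self_eq_zero, zero_mul]
        · have : ∃ w, f (s e) = some w ∧ f (t e) = some w := by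
            by_contra hne
            exact hd ⟨fun k hk => he (by simp [← hk]), hne⟩
          obtain ⟨w', h₁, h₂⟩ := this
          rw [h₁, h₂, CharTwo.add_self_eq_zero, mul_zero]
      rw [← Finset.sum_subset (Finset.subset_univ _) himg,
        Finset.sum_image fun _ _ _ _ h => εinj h]
      refine Finset.sum_congr rfl fun k _ => ?_
      rw [hx]
      rcases Sym2.eq_iff.1 (hε k) with ⟨h₁, h₂⟩ | ⟨h₁, h₂⟩
      · simp [h₁, h₂]
      · rw [h₁, h₂]
        simp [add_comm]
  obtain ⟨N, ⟨eq⟩⟩ := Finite.exists_equiv_fin (Quot R)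
  refine ⟨Fin N, inferInstance, fun k => eq (Quot.mk R (l (ε k))),
    fun k => eq (Quot.mk R (r (ε k))), fun c => (key c).trans ?_⟩
  constructor
  · rintro ⟨x, hx⟩
    exact ⟨x ∘ eq.symm, by simpa using hx⟩
  · rintro ⟨x, hx⟩
    exact ⟨x ∘ eq, hx⟩

/-- A multigraph with more than `2 ^ m` cycles, none of them shorter than `g`, has no algebraic
dual if it has fewer than `g * (m + 2) / 2` edges. -/
theorem not_isAlgebraicDual_of_card [Fintype K] [DecidableEq W] [Finite F] (p q : K → W)
    (l r : K → F) (g m : ℕ) (hK : 2 * Fintype.card K < g * (m + 2))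
    (hg : ∀ c : K → ZMod 2, (∀ v, boundary p q c v = 0) → c ≠ 0 →
      g ≤ (Finset.univ.filter fun k => c k ≠ 0).card)
    (ι : Type) [Fintype ι] (cyc : ι → K → ZMod 2) (hcyc : ∀ i v, boundary p q (cyc i) v = 0)
    (hinj : Function.Injective cyc) (hι : 2 ^ m < Fintype.card ι) :
    ¬ IsAlgebraicDual p q l r := by
  classical
  intro hd
  have := Fintype.ofFinite F
  let T : Finset F := Finset.univ.filter fun φ => ∃ k, l k ≠ r k ∧ (l k = φ ∨ r k = φ)
  have hdeg : ∀ φ ∈ T, g ≤ (Finset.univ.filter fun k => l k ≠ r k ∧ (l k = φ ∨ r k = φ)).card := by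
    intro φ hφ
    obtain ⟨k₀, hk₀⟩ := (Finset.mem_filter.1 hφ).2
    let x : F → ZMod 2 := Pi.single φ 1
    have hx : ∀ k, x (l k) + x (r k) ≠ 0 ↔ l k ≠ r k ∧ (l k = φ ∨ r k = φ) := by
      intro k
      by_cases h₁ : l k = φ <;> by_cases h₂ : r k = φ <;> simp [x, h₁, h₂]
      · exact CharTwo.add_self_eq_zero _
      · exact fun h => h₂ h.symm
    have := hg (fun k => x (l k) + x (r k)) ((hd _).2 ⟨x, fun _ => rfl⟩)
      fun h => (hx k₀).2 hk₀ (congrFun h k₀)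
    simpa only [hx] using this
  have hT : T.card * g ≤ 2 * Fintype.card K := by
    calc T.card * g ≤ ∑ φ ∈ T, (Finset.univ.filter fun k => l k ≠ r k ∧ (l k = φ ∨ r k = φ)).card := by
          rw [← smul_eq_mul]; exact Finset.card_nsmul_le_sum _ _ _ hdeg
      _ = ∑ k : K, (T.filter fun φ => l k ≠ r k ∧ (l k = φ ∨ r k = φ)).card :=
          Finset.sum_card_bipartiteAbove_eq_sum_card_bipartiteBelow _
      _ ≤ ∑ k : K, 2 := by
          refine Finset.sum_le_sum fun k _ => ?_
          refine (Finset.card_le_card (t := {l k, r k}) fun φ hφ => ?_).trans Finset.card_le_two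
          have := (Finset.mem_filter.1 hφ).2.2
          simpa [eq_comm] using this
      _ = 2 * Fintype.card K := by simp [mul_comm]
  have hTm : T.card ≤ m + 1 := by
    by_contra hlt
    have : g * (m + 2) ≤ T.card * g := by
      rw [mul_comm]; exact Nat.mul_le_mul_right _ (by omega)
    omega
  choose x hx using fun i => (hd (cyc i)).1 (hcyc i)
  let Φ : ι × ZMod 2 → T → ZMod 2 := fun y φ => x y.1 φ + y.2
  have hT0 : T.Nonempty := by
    by_contra hne
    have hlr : ∀ k, l k = r k := by
      intro k
      by_contra hk
      exact hne ⟨l k, by simp only [T, Finset.mem_filter_univ]; exact ⟨k, hk, .inl rfl⟩⟩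
    have hsub : Subsingleton ι := ⟨fun i j => hinj (by
      ext1 k
      rw [hx i, hx j, hlr, CharTwo.add_self_eq_zero, CharTwo.add_self_eq_zero])⟩
    have := Fintype.card_le_one_iff_subsingleton.2 hsub
    have := Nat.one_le_two_pow (n := m)
    omega
  have hΦ : Function.Injective Φ := by
    rintro ⟨i, a⟩ ⟨j, b⟩ h
    have hφ : ∀ φ (_ : φ ∈ T), x i φ + a = x j φ + b := fun φ hφ => congrFun h ⟨φ, hφ⟩
    have hij : i = j := by
      apply hinj
      ext1 k
      rw [hx i, hx j]
      by_cases hk : l k = r k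
      · rw [hk, CharTwo.add_self_eq_zero, CharTwo.add_self_eq_zero]
      · have h₁ := hφ (l k) (by simp only [T, Finset.mem_filter_univ]; exact ⟨k, hk, .inl rfl⟩)
        have h₂ := hφ (r k) (by simp only [T, Finset.mem_filter_univ]; exact ⟨k, hk, .inr rfl⟩)
        linear_combination h₁ + h₂ + CharTwo.add_self_eq_zero b - CharTwo.add_self_eq_zero a
    subst hij
    obtain ⟨φ, hφ'⟩ := hT0
    rw [add_left_cancel (hφ φ hφ')]
  have hcard := Fintype.card_le_of_injective Φ hΦ
  simp only [Fintype.card_prod, ZMod.card, Fintype.card_fun, Fintype.card_coe] at hcard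
  have := Nat.pow_le_pow_right (n := 2) (by norm_num) hTm
  rw [pow_succ] at this
  omega

end Duality

section Kuratowski

theorem completeBipartiteGraph_boundary (c : Fin 3 × Fin 3 → ZMod 2) :
    (∀ v, boundary (fun k => Sum.inl k.1) (fun k => Sum.inr k.2) c v = 0) ↔
      (∀ i, c (i, 0) + c (i, 1) + c (i, 2) = 0) ∧ ∀ j, c (0, j) + c (1, j) + c (2, j) = 0 := by
  rw [Sum.forall]
  refine and_congr (forall_congr' fun i => ?_) (forall_congr' fun j => ?_)
  · fin_cases i <;>
      simp [boundary, Fintype.sum_prod_type, Fin.sum_univ_three]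
  · fin_cases j <;>
      simp [boundary, Fintype.sum_prod_type, Fin.sum_univ_three]

set_option synthInstance.maxSize 5000 in
set_option synthInstance.maxHeartbeats 4000000 in
theorem completeBipartiteGraph_not_isAlgebraicDual {F : Type*} [Finite F]
    (l r : Fin 3 × Fin 3 → F) :
    ¬ IsAlgebraicDual (fun k => (Sum.inl k.1 : Fin 3 ⊕ Fin 3)) (fun k => Sum.inr k.2) l r := by
  refine not_isAlgebraicDual_of_card _ _ l r 4 3 (by simp) ?_
    (ZMod 2 × ZMod 2 × ZMod 2 × ZMod 2)
    (fun y k => ![![y.1, y.2.1, y.1 + y.2.1], ![y.2.2.1, y.2.2.2, y.2.2.1 + y.2.2.2],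
      ![y.1 + y.2.2.1, y.2.1 + y.2.2.2, y.1 + y.2.1 + y.2.2.1 + y.2.2.2]] k.1 k.2) ?_ ?_
    (by simp [ZMod.card])
  · intro c hc hne
    rw [completeBipartiteGraph_boundary] at hc
    simp only [Fin.forall_fin_succ, IsEmpty.forall_iff, and_true] at hc
    rw [Finset.card_filter]
    simp only [Fintype.sum_prod_type, Fin.sum_univ_three]
    have hne' : ¬ (c (0, 0) = 0 ∧ c (0, 1) = 0 ∧ c (0, 2) = 0 ∧ c (1, 0) = 0 ∧ c (1, 1) = 0 ∧
        c (1, 2) = 0 ∧ c (2, 0) = 0 ∧ c (2, 1) = 0 ∧ c (2, 2) = 0) := by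
      rintro ⟨h₁, h₂, h₃, h₄, h₅, h₆, h₇, h₈, h₉⟩
      apply hne
      ext1 ⟨i, j⟩
      fin_cases i <;> fin_cases j <;> assumption
    obtain ⟨⟨h₁, h₂, h₃⟩, h₄, h₅, h₆⟩ := hc
    clear hne
    simp only [Fin.succ_zero_eq_one, Fin.succ_one_eq_two] at *
    generalize c (0, 0) = a, c (0, 1) = b, c (0, 2) = d, c (1, 0) = e, c (1, 1) = f,
      c (1, 2) = g, c (2, 0) = h, c (2, 1) = i, c (2, 2) = j at *
    revert h i j h₃ h₄ h₅ h₆ hne'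
    revert e f g h₂
    revert a b d h₁
    decide
  · intro y
    rw [completeBipartiteGraph_boundary]
    revert y
    decide
  · decide

/-- The edges of the complete graph on `Fin 5`, by first and second endpoint. -/
def kFiveFst : Fin 10 → Fin 5 := ![0, 0, 0, 0, 1, 1, 1, 2, 2, 3]

/-- The second endpoints of the edges of the complete graph on `Fin 5`. -/
def kFiveSnd : Fin 10 → Fin 5 := ![1, 2, 3, 4, 2, 3, 4, 3, 4, 4]

theorem sum_fin_ten {M : Type*} [AddCommMonoid M] (g : Fin 10 → M) :
    ∑ i, g i = g 0 + g 1 + g 2 + g 3 + g 4 + g 5 + g 6 + g 7 + g 8 + g 9 := by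
  simp [Fin.sum_univ_succ, add_assoc]

theorem kFive_boundary (c : Fin 10 → ZMod 2) :
    (∀ v, boundary kFiveFst kFiveSnd c v = 0) ↔
      c 0 + c 1 + c 2 + c 3 = 0 ∧ c 0 + c 4 + c 5 + c 6 = 0 ∧ c 1 + c 4 + c 7 + c 8 = 0 ∧
        c 2 + c 5 + c 7 + c 9 = 0 ∧ c 3 + c 6 + c 8 + c 9 = 0 := by
  have h : ∀ v, boundary kFiveFst kFiveSnd c v = ![c 0 + c 1 + c 2 + c 3,
      c 0 + c 4 + c 5 + c 6, c 1 + c 4 + c 7 + c 8, c 2 + c 5 + c 7 + c 9,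
      c 3 + c 6 + c 8 + c 9] v := by
    intro v
    rw [boundary, sum_fin_ten]
    fin_cases v <;> simp [kFiveFst, kFiveSnd]
  simp only [h, Fin.forall_fin_succ, IsEmpty.forall_iff, and_true]
  rfl

set_option synthInstance.maxSize 5000 in
set_option synthInstance.maxHeartbeats 4000000 in
theorem kFive_not_isAlgebraicDual {F : Type*} [Finite F] (l r : Fin 10 → F) :
    ¬ IsAlgebraicDual kFiveFst kFiveSnd l r := by
  refine not_isAlgebraicDual_of_card _ _ l r 3 5 (by simp) ?_
    (ZMod 2 × ZMod 2 × ZMod 2 × ZMod 2 × ZMod 2 × ZMod 2)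
    (fun y => ![y.1 + y.2.1 + y.2.2.1, y.1 + y.2.2.2.1 + y.2.2.2.2.1,
      y.2.1 + y.2.2.2.1 + y.2.2.2.2.2, y.2.2.1 + y.2.2.2.2.1 + y.2.2.2.2.2,
      y.1, y.2.1, y.2.2.1, y.2.2.2.1, y.2.2.2.2.1, y.2.2.2.2.2]) ?_ ?_ (by simp [ZMod.card])
  · intro c hc hne
    rw [kFive_boundary] at hc
    rw [Finset.card_filter]
    have hne' : ¬ (c 0 = 0 ∧ c 1 = 0 ∧ c 2 = 0 ∧ c 3 = 0 ∧ c 4 = 0 ∧ c 5 = 0 ∧ c 6 = 0 ∧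
        c 7 = 0 ∧ c 8 = 0 ∧ c 9 = 0) := by
      rintro ⟨h₁, h₂, h₃, h₄, h₅, h₆, h₇, h₈, h₉, h₁₀⟩
      apply hne
      ext1 i
      fin_cases i <;> assumption
    obtain ⟨h₁, h₂, h₃, h₄, h₅⟩ := hc
    clear hne
    rw [sum_fin_ten]
    generalize c 0 = x₀, c 1 = x₁, c 2 = x₂, c 3 = x₃, c 4 = x₄, c 5 = x₅, c 6 = x₆, c 7 = x₇,
      c 8 = x₈, c 9 = x₉ at *
    revert x₉ h₄ h₅ hne'
    revert x₇ x₈ h₃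
    revert x₄ x₅ x₆ h₂
    revert x₀ x₁ x₂ x₃ h₁
    decide
  · intro y
    rw [kFive_boundary]
    revert y
    decide
  · intro y y' h
    have h₄ := congrFun h 4
    have h₅ := congrFun h 5
    have h₆ := congrFun h 6
    have h₇ := congrFun h 7
    have h₈ := congrFun h 8
    have h₉ := congrFun h 9
    exact Prod.ext h₄ (Prod.ext h₅ (Prod.ext h₆ (Prod.ext h₇ (Prod.ext h₈ h₉))))

/-- A finite graph carried by a multigraph with an algebraic dual is planar. -/
theorem SimpleGraph.Planar.of_isAlgebraicDual {V E F : Type*} [Finite V] [DecidableEq V]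
    [Fintype E] [Finite F] {G : SimpleGraph V} (s t : E → V) (l r : E → F)
    (hG : ∀ u v, G.Adj u v → ∃ e, (s e = u ∧ t e = v) ∨ (s e = v ∧ t e = u))
    (hdual : IsAlgebraicDual s t l r) : G.Planar := by
  constructor
  · intro h
    obtain ⟨F', _, l', r', h'⟩ := h.exists_isAlgebraicDual s t l r hG hdual kFiveFst kFiveSnd
      (by simp only [SimpleGraph.top_adj]; decide) (by decide)
    exact kFive_not_isAlgebraicDual l' r' h'
  · intro h
    obtain ⟨F', _, l', r', h'⟩ := h.exists_isAlgebraicDual s t l r hG hdual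
      (fun k : Fin 3 × Fin 3 => Sum.inl k.1) (fun k => Sum.inr k.2) (by simp)
      (by rintro ⟨i, j⟩ ⟨i', j'⟩ h; simpa using h)
    exact completeBipartiteGraph_not_isAlgebraicDual l' r' h'

end Kuratowski

section Gamma

variable {n : ℕ}

theorem Gamma_adj_inl_inl {a b q : ℕ} (i j : ZMod n) :
    (Gamma n {a} {b} {q}).Adj (.inl i) (.inl j) ↔ i ≠ j ∧ (j = i + a ∨ i = j + a) := by
  simp [Gamma]

theorem Gamma_adj_inr_inr {a b q : ℕ} (i j : ZMod n) :
    (Gamma n {a} {b} {q}).Adj (.inr i) (.inr j) ↔ i ≠ j ∧ (j = i + b ∨ i = j + b) := by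
  simp [Gamma]

theorem Gamma_adj_inl_inr {a b q : ℕ} (i j : ZMod n) :
    (Gamma n {a} {b} {q}).Adj (.inl i) (.inr j) ↔ j = i + q := by
  simp [Gamma]

theorem Gamma_adj_inr_inl {a b q : ℕ} (i j : ZMod n) :
    (Gamma n {a} {b} {q}).Adj (.inr j) (.inl i) ↔ j = i + q := by
  rw [SimpleGraph.adj_comm, Gamma_adj_inl_inr]

/-- Contracting the spokes of `Γ_n({a},{b},{q})` gives the circulant graph on `±a`, `±b`. -/
theorem planar_twoCirc_of_planar_Gamma {a b q : ℕ} (h : (Gamma n {a} {b} {q}).Planar) :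
    (SimpleGraph.twoCirc (a : ZMod n) b).Planar := by
  refine h.of_contraction (Sum.elim id fun j => j - q) (fun i => ⟨.inl i, rfl⟩) ?_ ?_
  · rintro (i | i) (j | j) hij
    · exact .inl (congrArg _ hij)
    · simp only [Sum.elim_inl, Sum.elim_inr, id_eq] at hij
      exact .inr ((Gamma_adj_inl_inr _ _).2 (by rw [hij]; ring))
    · simp only [Sum.elim_inl, Sum.elim_inr, id_eq] at hij
      exact .inr ((Gamma_adj_inr_inl _ _).2 (by rw [← hij]; ring))
    · exact .inl (congrArg _ (sub_left_injective hij))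
  · intro x y hxy
    simp only [SimpleGraph.twoCirc, SimpleGraph.fromRel_adj] at hxy
    obtain ⟨hne, hxy⟩ := hxy
    by_cases ha : y = x + a ∨ x = y + a
    · exact ⟨.inl x, .inl y, rfl, rfl, (Gamma_adj_inl_inl _ _).2 ⟨hne, ha⟩⟩
    · refine ⟨.inr (x + q), .inr (y + q), by simp, by simp,
        (Gamma_adj_inr_inr _ _).2 ⟨fun h => hne (add_right_cancel h), ?_⟩⟩
      have hb : y = x + b ∨ x = y + b := by tauto
      rcases hb with hb | hb
      · left; rw [hb]; ring
      · right; rw [hb]; ring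

theorem gcd_eq_one_of_connected_Gamma {a b q : ℕ} (h : (Gamma n {a} {b} {q}).Connected) :
    (n.gcd a).gcd b = 1 := by
  set d := (n.gcd a).gcd b with hd
  have hdn : d ∣ n := (Nat.gcd_dvd_left _ _).trans (Nat.gcd_dvd_left _ _)
  have ha : (a : ZMod d) = 0 := (ZMod.natCast_eq_zero_iff _ _).2
    ((Nat.gcd_dvd_left _ _).trans (Nat.gcd_dvd_right _ _))
  have hb : (b : ZMod d) = 0 := (ZMod.natCast_eq_zero_iff _ _).2 (Nat.gcd_dvd_right _ _)
  let f := ZMod.castHom hdn (ZMod d)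
  let φ : ZMod n ⊕ ZMod n → ZMod d := Sum.elim f fun j => f j - q
  have hφ : ∀ u v, (Gamma n {a} {b} {q}).Adj u v → φ u = φ v := by
    rintro (i | i) (j | j) hij
    · rcases ((Gamma_adj_inl_inl _ _).1 hij).2 with h | h <;> simp [φ, h, ha]
    · simp [φ, (Gamma_adj_inl_inr _ _).1 hij]
    · simp [φ, (Gamma_adj_inr_inl _ _).1 hij]
    · rcases ((Gamma_adj_inr_inr _ _).1 hij).2 with h | h <;> simp [φ, h, hb]
  have hreach : ∀ u v, (Gamma n {a} {b} {q}).Reachable u v → φ u = φ v := by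
    rintro u v ⟨p⟩
    induction p with
    | nil => rfl
    | cons h _ ih => exact (hφ _ _ h).trans ih
  have h01 := hreach (.inl 0) (.inl 1) (h.preconnected _ _)
  simp only [φ, Sum.elim_inl, map_zero, map_one] at h01
  have := (ZMod.natCast_eq_zero_iff 1 d).1 (by simpa using h01.symm)
  exact Nat.dvd_one.1 this

/-- `a` and `b` generate the additive group `ZMod n`. -/
def Generates (a b : ZMod n) : Prop := ∃ α β : ℤ, (α : ZMod n) * a + β * b = 1

theorem Generates.symm {a b : ZMod n} (h : Generates a b) : Generates b a := by
  obtain ⟨α, β, h⟩ := h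
  exact ⟨β, α, by rw [add_comm, h]⟩

theorem Generates.of_isUnit {a : ZMod n} (h : IsUnit a) (b : ZMod n) : Generates a b := by
  obtain ⟨c, hc⟩ := h.exists_left_inv
  obtain ⟨α, rfl⟩ := ZMod.intCast_surjective c
  exact ⟨α, 0, by simpa using hc⟩

theorem Generates.mem {a b : ZMod n} (h : Generates a b) (H : AddSubgroup (ZMod n))
    (ha : a ∈ H) (hb : b ∈ H) (x : ZMod n) : x ∈ H := by
  obtain ⟨α, β, h⟩ := h
  have h1 : (1 : ZMod n) ∈ H := by
    rw [← h, ← zsmul_eq_mul, ← zsmul_eq_mul]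
    exact H.add_mem (H.zsmul_mem ha _) (H.zsmul_mem hb _)
  obtain ⟨k, rfl⟩ := ZMod.intCast_surjective x
  simpa using H.zsmul_mem h1 k

theorem Generates.eq_const {X : Type*} {a b : ZMod n} (h : Generates a b) (g : ZMod n → X)
    (ha : ∀ i, g i = g (i - a)) (hb : ∀ i, g i = g (i - b)) (i : ZMod n) : g i = g 0 := by
  let H : AddSubgroup (ZMod n) :=
    { carrier := {d | ∀ i, g i = g (i - d)}
      zero_mem' := by simp
      add_mem' := fun {x y} hx hy i => by rw [hx i, hy (i - x), sub_sub]
      neg_mem' := fun {x} hx i => by rw [hx (i - -x)]; congr 1; ring }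
  simpa using h.mem H ha hb i i

theorem connected_Gamma {a b q : ℕ} (hgen : Generates (a : ZMod n) b) :
    (Gamma n {a} {b} {q}).Connected := by
  set G := Gamma n {a} {b} {q} with hG
  have of_rel : ∀ u v, u = v ∨ G.Adj u v → G.Reachable u v := by
    rintro u v (rfl | h)
    · exact SimpleGraph.Reachable.refl _
    · exact h.reachable
  have spoke : ∀ i, G.Reachable (.inl i) (.inr (i + q)) := fun i =>
    of_rel _ _ (.inr ((Gamma_adj_inl_inr _ _).2 rfl))
  let H : AddSubgroup (ZMod n) :=
    { carrier := {d | ∀ i, G.Reachable (.inl i) (.inl (i + d))}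
      zero_mem' := fun i => by rw [add_zero]
      add_mem' := fun {x y} hx hy i => by
        rw [← add_assoc]
        exact (hx i).trans (hy (i + x))
      neg_mem' := fun {x} hx i => by
        have := hx (i + -x)
        rw [neg_add_cancel_right] at this
        exact this.symm }
  have ha : (a : ZMod n) ∈ H := by
    intro i
    refine of_rel _ _ ?_
    by_cases h : i = i + a
    · exact .inl (congrArg _ h)
    · exact .inr ((Gamma_adj_inl_inl _ _).2 ⟨h, .inl rfl⟩)
  have hb : (b : ZMod n) ∈ H := by
    intro i
    refine (spoke i).trans ((of_rel _ _ ?_).trans (spoke (i + b)).symm)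
    by_cases h : i + q = i + b + q
    · exact .inl (congrArg _ h)
    · exact .inr ((Gamma_adj_inr_inr _ _).2 ⟨h, .inl (by ring)⟩)
  have hinl : ∀ v, G.Reachable (.inl 0) v := by
    have h0 : ∀ i, G.Reachable (.inl 0) (.inl i) := fun i => by
      simpa using hgen.mem H ha hb i 0
    rintro (i | i)
    · exact h0 i
    · have := (h0 (i - q)).trans (spoke (i - q))
      rwa [sub_add_cancel] at this
  have : Nonempty (ZMod n ⊕ ZMod n) := ⟨.inl 0⟩
  exact SimpleGraph.Connected.mk fun u v => (hinl u).symm.trans (hinl v)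

/-- Algebraic duals of `Γ_n({a},{b},{q})`, in terms of the values of a chain on the edges
`(v_i, v_{i+a})`, `(v'_{i+q}, v'_{i+q+b})` and `(v_i, v'_{i+q})`. -/
def IsGammaDual {F : Type} (a b : ZMod n) (l₁ r₁ l₂ r₂ l₃ r₃ : ZMod n → F) : Prop :=
  ∀ z₁ z₂ z₃ : ZMod n → ZMod 2,
    ((∀ i, z₁ i + z₁ (i - a) + z₃ i = 0) ∧ ∀ i, z₂ i + z₂ (i - b) + z₃ i = 0) ↔
      ∃ x : F → ZMod 2, (∀ i, z₁ i = x (l₁ i) + x (r₁ i)) ∧ (∀ i, z₂ i = x (l₂ i) + x (r₂ i)) ∧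
        ∀ i, z₃ i = x (l₃ i) + x (r₃ i)

theorem IsGammaDual.symm {F : Type} {a b : ZMod n} {l₁ r₁ l₂ r₂ l₃ r₃ : ZMod n → F}
    (h : IsGammaDual a b l₁ r₁ l₂ r₂ l₃ r₃) : IsGammaDual b a l₂ r₂ l₁ r₁ l₃ r₃ := by
  intro z₁ z₂ z₃
  rw [and_comm, h z₂ z₁ z₃]
  exact exists_congr fun x => by tauto

theorem IsGammaDual.planar [NeZero n] {F : Type} [Finite F] {A B : ZMod n}
    {l₁ r₁ l₂ r₂ l₃ r₃ : ZMod n → F} (h : IsGammaDual A B l₁ r₁ l₂ r₂ l₃ r₃) {a b q : ℕ}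
    (ha : (a : ZMod n) = A ∨ (a : ZMod n) = -A) (hb : (b : ZMod n) = B ∨ (b : ZMod n) = -B) :
    (Gamma n {a} {b} {q}).Planar := by
  let s : ZMod n ⊕ ZMod n ⊕ ZMod n → ZMod n ⊕ ZMod n :=
    Sum.elim .inl (Sum.elim (fun i => .inr (i + q)) .inl)
  let t : ZMod n ⊕ ZMod n ⊕ ZMod n → ZMod n ⊕ ZMod n :=
    Sum.elim (fun i => .inl (i + A)) (Sum.elim (fun i => .inr (i + q + B)) (fun i => .inr (i + q)))
  refine SimpleGraph.Planar.of_isAlgebraicDual s t (Sum.elim l₁ (Sum.elim l₂ l₃))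
    (Sum.elim r₁ (Sum.elim r₂ r₃)) ?_ ?_
  · have shift : ∀ {c C i j : ZMod n}, c = C ∨ c = -C → j = i + c ∨ i = j + c →
        j = i + C ∨ i = j + C := by
      rintro c C i j (rfl | rfl) (h | h)
      · exact .inl h
      · exact .inr h
      · right; rw [h]; ring
      · left; rw [h]; ring
    rintro (i | i) (j | j) hij
    · rcases shift ha ((Gamma_adj_inl_inl _ _).1 hij).2 with h | h
      · exact ⟨.inl i, .inl ⟨rfl, by simp [t, h]⟩⟩
      · exact ⟨.inl j, .inr ⟨rfl, by simp [t, h]⟩⟩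
    · exact ⟨.inr (.inr i), .inl ⟨rfl, by simp [t, (Gamma_adj_inl_inr _ _).1 hij]⟩⟩
    · exact ⟨.inr (.inr j), .inr ⟨rfl, by simp [t, (Gamma_adj_inr_inl _ _).1 hij]⟩⟩
    · rcases shift hb ((Gamma_adj_inr_inr _ _).1 hij).2 with h | h
      · exact ⟨.inr (.inl (i - q)), .inl ⟨by simp [s], by simp [t, h]⟩⟩
      · exact ⟨.inr (.inl (j - q)), .inr ⟨by simp [s], by simp [t, h]⟩⟩
  · intro z
    have e₁ : ∀ i, boundary s t z (.inl i) = z (.inl i) + z (.inl (i - A)) +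
        z (.inr (.inr i)) := by
      intro i
      have : ∀ j, j + A = i ↔ j = i - A := fun j => eq_sub_iff_add_eq.symm
      simp [boundary, s, t, mul_add, Finset.sum_add_distrib, this]
      ring
    have e₂ : ∀ i, boundary s t z (.inr (i + q)) = z (.inr (.inl i)) + z (.inr (.inl (i - B))) +
        z (.inr (.inr i)) := by
      intro i
      have : ∀ j, j + q + B = i + q ↔ j = i - B := fun j => by
        rw [eq_sub_iff_add_eq, add_right_comm, add_left_inj]
      simp [boundary, s, t, mul_add, Finset.sum_add_distrib, this]
      ring
    have := h (fun i => z (.inl i)) (fun i => z (.inr (.inl i))) fun i => z (.inr (.inr i))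
    rw [Sum.forall]
    simp only [e₁]
    have hshift : (∀ j, boundary s t z (.inr j) = 0) ↔ ∀ i, boundary s t z (.inr (i + q)) = 0 :=
      ⟨fun h i => h _, fun h j => by simpa using h (j - q)⟩
    rw [hshift]
    simp only [e₂]
    rw [this]
    simp [Sum.forall]

theorem isGammaDual_prism {a : ZMod n} (ha : IsUnit a) :
    IsGammaDual (F := ZMod 2 ⊕ ZMod n) a a (fun _ => .inl 0) .inr (fun _ => .inl 1) .inr
      (fun i => .inr (i - a)) .inr := by
  intro z₁ z₂ z₃
  constructor
  · rintro ⟨h₁, h₂⟩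
    have hg := (Generates.of_isUnit ha a).eq_const (fun i => z₁ i + z₂ i)
      (fun i => by grind) (fun i => by grind)
    refine ⟨Sum.elim (fun y => y * (z₁ 0 + z₂ 0)) z₁, fun i => ?_, fun i => ?_, fun i => ?_⟩
    · simp
    · simp only [Sum.elim_inl, Sum.elim_inr]
      grind
    · simp only [Sum.elim_inr]
      grind
  · rintro ⟨x, h₁, h₂, h₃⟩
    constructor <;> intro i
    · rw [h₁, h₁, h₃]; grind
    · rw [h₂, h₂, h₃]; grind

theorem isGammaDual_two_mul {u : ZMod n} (hu : IsUnit u) (par : ZMod n →+* ZMod 2) :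
    IsGammaDual (F := ZMod 2 ⊕ ZMod n) u (2 * u) .inr (fun i => .inr (i - u))
      .inr (fun i => .inl (par i)) .inr (fun i => .inr (i - 2 * u)) := by
  have hpar : par u = 1 := by
    have h := hu.map par
    revert h
    generalize par u = y
    decide +revert
  have hsub : ∀ i : ZMod n, i - u - u = i - 2 * u := fun i => by ring
  intro z₁ z₂ z₃
  constructor
  · rintro ⟨h₁, h₂⟩
    have hshift : ∀ i, z₁ i + z₂ i + z₂ (i - u) =
        z₁ (i - u) + z₂ (i - u) + z₂ (i - u - u) := fun i => by
      have := h₁ i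
      have := h₂ i
      rw [hsub]
      grind
    have hg := (Generates.of_isUnit hu u).eq_const (fun i => z₁ i + z₂ i + z₂ (i - u))
      hshift hshift
    refine ⟨Sum.elim (fun y => y * (z₁ 0 + z₂ 0 + z₂ (0 - u)))
      (fun i => z₂ i + par i * (z₁ 0 + z₂ 0 + z₂ (0 - u))), fun i => ?_, fun i => ?_, fun i => ?_⟩
    · simp only [Sum.elim_inr, map_sub, hpar]
      have := hg i
      grind
    · simp only [Sum.elim_inl, Sum.elim_inr]
      grind
    · simp only [Sum.elim_inr, map_sub, map_mul, hpar, map_ofNat]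
      have := h₂ i
      grind
  · rintro ⟨x, h₁, h₂, h₃⟩
    beta_reduce at h₁ h₂ h₃
    constructor <;> intro i
    · rw [h₁, h₁, h₃, hsub]; grind
    · have : par (i - 2 * u) = par i := by
        rw [two_mul, map_sub, map_add, CharTwo.add_self_eq_zero, sub_zero]
      rw [h₂, h₂, h₃, this]
      grind

theorem isGammaDual_half {s m : ZMod n} (hgen : Generates s m) (hm : m + m = 0)
    (par : ZMod n →+* ZMod 2) (hs : par s = 0) (hpm : par m = 1) (e : ZMod n → ZMod n)
    (he : ∀ i, e i = if par i = 0 then i else i + m) :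
    IsGammaDual (F := ZMod 2 ⊕ ZMod n ⊕ ZMod n) s m
      (fun i => .inl (par i)) (fun i => .inr (.inl (e i)))
      (fun i => .inr (.inr (e i))) (fun i => .inr (.inl (if par i = 0 then e i else e i - s)))
      (fun i => .inr (.inl (e i))) (fun i => .inr (.inl (e i - s))) := by
  have htwo : ∀ y : ZMod 2, y = 0 ∨ y = 1 := by decide
  have hneg : ∀ i, i - m = i + m := fun i => by grind
  have hmm : ∀ i, i + m + m = i := fun i => by grind
  have hcomm : ∀ i, i + m - s = i - s + m := fun i => by ring
  have hsub : ∀ i, par (i - s) = par i := fun i => by simp [hs]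
  have hadd : ∀ i, par (i + m) = par i + 1 := fun i => by simp [hpm]
  have h10 : (1 : ZMod 2) ≠ 0 := by decide
  have h11 : (1 : ZMod 2) + 1 = 0 := rfl
  intro z₁ z₂ z₃
  constructor
  · rintro ⟨h₁, h₂⟩
    simp only [hneg] at h₂
    have hz₃ : ∀ i, z₃ (i + m) = z₃ i := fun i => by
      have := h₂ i
      have := h₂ (i + m)
      rw [hmm] at this
      grind
    have hg := hgen.eq_const (fun i => z₁ i + z₁ (i + m))
      (fun i => by
        have := h₁ i
        have := h₁ (i + m)
        rw [hcomm, hz₃] at this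
        grind)
      (fun i => by rw [hneg, hmm, add_comm])
    refine ⟨Sum.elim (fun y => y * (z₁ 0 + z₁ (0 + m)))
      (Sum.elim z₁ (fun i => z₂ i + z₁ i)), fun i => ?_, fun i => ?_, fun i => ?_⟩
    all_goals
      simp only [Sum.elim_inl, Sum.elim_inr, he]
      have := hg i
      have := h₁ i
      have := h₁ (i + m)
      have := h₂ i
      have := hz₃ i
      rcases htwo (par i) with hp | hp <;> simp only [hp, if_true, if_false, h10] <;> grind
  · rintro ⟨x, h₁, h₂, h₃⟩
    constructor <;> intro i
    · rw [h₁, h₁, h₃]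
      simp only [he, hsub]
      rcases htwo (par i) with hp | hp <;>
        simp only [hp, if_true, if_false, h10, hcomm] <;> grind
    · rw [h₂, h₂, h₃]
      simp only [he, hneg, hadd]
      rcases htwo (par i) with hp | hp <;>
        simp only [hp, if_true, if_false, h10, h11, hmm, zero_add] <;> grind

end Gamma

section Classification

open SimpleGraph

variable {n : ℕ}

theorem ZMod.even_and_eq_two_mul_of_planar_twoCirc [NeZero n] {u b : ZMod n} (hn : 5 ≤ n)
    (hu : IsUnit u) (hb0 : b ≠ 0) (hbu : b ≠ u) (hbu' : b ≠ -u) (h2b : 2 * b ≠ 0)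
    (hpl : (twoCirc u b).Planar) : Even n ∧ (b = 2 * u ∨ b = -(2 * u)) := by
  have hu0 : u ≠ 0 := by
    rintro rfl
    have : Fact (1 < n) := ⟨by omega⟩
    exact not_isUnit_zero hu
  obtain ⟨v, hv⟩ := hu.exists_left_inv
  have key : ∀ c : ℕ, 2 * c ≤ n → ∀ d : ZMod n, d = c * u → d ≠ 0 → d ≠ u → 2 * d ≠ 0 →
      (twoCirc u d).Planar → Even n ∧ d = 2 * u := by
    rintro c hc d rfl hd0 hdu h2d hpl
    rcases Nat.lt_or_ge c 3 with h3 | h3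
    · interval_cases c
      · simp at hd0
      · simp at hdu
      · refine ⟨?_, by simp⟩
        by_contra hodd
        rw [Nat.not_even_iff] at hodd
        exact not_planar_twoCirc_two_mul hn hodd hu hu0 (by simpa using hd0) (by simpa using hpl)
    · exfalso
      rcases (by omega : 2 * c + 2 ≤ n ∨ n = 2 * c + 1 ∨ n = 2 * c) with h | h | h
      · exact not_planar_twoCirc_natCast_mul h3 h hu hu0 hd0 hpl
      · have hcast : (2 * c + 1 : ZMod n) = 0 := by
          have := ZMod.natCast_self n
          rw [h] at this ⊢
          exact_mod_cast this
        have hud : u = -(2 * (c * u)) := by linear_combination u * hcast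
        have hcu : IsUnit ((c : ZMod n) * u) := by
          refine IsUnit.mul ?_ hu
          exact IsUnit.of_mul_eq_one (-2) (by linear_combination -hcast)
        rw [twoCirc_comm] at hpl
        conv at hpl => enter [1, 2]; rw [hud]
        rw [twoCirc_neg] at hpl
        exact not_planar_twoCirc_two_mul hn (by omega) hcu hd0 h2d hpl
      · apply h2d
        have hcast : (2 * c : ZMod n) = 0 := by
          have := ZMod.natCast_self n
          rw [h] at this ⊢
          exact_mod_cast this
        linear_combination u * hcast
  have hbc : b = ((b * v).val : ZMod n) * u := by
    rw [ZMod.natCast_val, ZMod.cast_id, mul_assoc, hv, mul_one]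
  have hlt := ZMod.val_lt (b * v)
  set c := (b * v).val
  rcases Nat.lt_or_ge n (2 * c) with h | h
  · obtain ⟨he, h⟩ := key (n - c) (by omega) (-b)
      (by rw [Nat.cast_sub hlt.le, ZMod.natCast_self, zero_sub, neg_mul, ← hbc])
      (neg_ne_zero.2 hb0) (fun h => hbu' (by rw [← h, neg_neg]))
      (by rwa [mul_neg, neg_ne_zero]) (by rwa [twoCirc_neg])
    exact ⟨he, .inr (by rw [← h, neg_neg])⟩
  · obtain ⟨he, h⟩ := key c h b hbc hb0 hbu h2b hpl
    exact ⟨he, .inl h⟩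

theorem ZMod.natCast_ne_zero_of_mem_Ico {a : ℕ} (ha : a ∈ Finset.Ico 1 n) : (a : ZMod n) ≠ 0 := by
  rw [Finset.mem_Ico] at ha
  rw [Ne, ZMod.natCast_eq_zero_iff]
  exact Nat.not_dvd_of_pos_of_lt ha.1 ha.2

theorem Nat.eq_two_mul_of_two_mul_natCast_eq_zero {b : ℕ} (hb : b ∈ Finset.Ico 1 n)
    (h2b : 2 * (b : ZMod n) = 0) : n = 2 * b := by
  rw [Finset.mem_Ico] at hb
  obtain ⟨k, hk⟩ := (ZMod.natCast_eq_zero_iff (2 * b) n).1 (by exact_mod_cast h2b)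
  have : k = 1 := by
    rcases (by omega : k = 0 ∨ k = 1 ∨ 2 ≤ k) with h | h | h
    · subst h; omega
    · exact h
    · nlinarith
  subst this; omega

theorem half_of_planar_twoCirc {a b : ℕ} (hn : 5 ≤ n) (ha : a ∈ Finset.Ico 1 n)
    (hb : b ∈ Finset.Ico 1 n) (h2b : 2 * (b : ZMod n) = 0) (hcop : (n.gcd a).gcd b = 1)
    (hpl : (twoCirc (a : ZMod n) b).Planar) :
    n % 4 = 2 ∧ Even a ∧ Nat.gcd (n / 2) a = 1 ∧ b = n / 2 := by
  have hnb := Nat.eq_two_mul_of_two_mul_natCast_eq_zero hb h2b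
  have ha0 := ZMod.natCast_ne_zero_of_mem_Ico ha
  have hb0 := ZMod.natCast_ne_zero_of_mem_Ico hb
  have hba : Nat.gcd b a = 1 := by
    rw [← hcop, Nat.gcd_comm n, Nat.gcd_assoc, Nat.gcd_comm a, hnb, Nat.gcd_mul_left_left]
  have hdiv : n / 2 = b := by omega
  rw [hdiv]
  rcases Nat.even_or_odd a with he | ho
  · refine ⟨?_, he, hba, rfl⟩
    have : ¬ 2 ∣ b := fun h => by
      have := Nat.dvd_gcd h he.two_dvd
      rw [hba] at this
      omega
    omega
  · exfalso
    have hu : IsUnit (a : ZMod n) := by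
      rw [ZMod.isUnit_iff_coprime, hnb]
      exact Nat.Coprime.mul_right ho.coprime_two_right (Nat.Coprime.symm hba)
    have hmul : (b : ZMod n) * a = b := by
      obtain ⟨k, rfl⟩ := ho
      push_cast
      linear_combination (k : ZMod n) * h2b
    exact not_planar_twoCirc_half (m := b) (by omega) hnb hu ha0 (by rwa [hmul])
      (by rwa [hmul])

end Classification

theorem stmt17 (n : ℕ) (hn : 5 ≤ n) (a b q : ℕ)
    (ha : a ∈ Finset.Ico 1 n) (hb : b ∈ Finset.Ico 1 n) (hq : q < n)
    (hpg : ProperlyGiven n {a} {b}) :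
    ((Gamma n {a} {b} {q}).Connected ∧ (Gamma n {a} {b} {q}).Planar) ↔
    ((((a : ZMod n) = (b : ZMod n) ∨ (a : ZMod n) = -(b : ZMod n)) ∧ Nat.gcd n a = 1) ∨
     (Even n ∧ ∃ s : ℕ, Nat.gcd n s = 1 ∧
        (((a : ZMod n) = (s : ZMod n) ∧
           ((b : ZMod n) = 2 * (s : ZMod n) ∨ (b : ZMod n) = -(2 * (s : ZMod n)))) ∨
         ((b : ZMod n) = (s : ZMod n) ∧
           ((a : ZMod n) = 2 * (s : ZMod n) ∨ (a : ZMod n) = -(2 * (s : ZMod n)))))) ∨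
     (n % 4 = 2 ∧ ∃ s : ℕ, Even s ∧ Nat.gcd (n / 2) s = 1 ∧
        (((a : ZMod n) = (s : ZMod n) ∧ (b : ZMod n) = ((n / 2 : ℕ) : ZMod n)) ∨
         ((b : ZMod n) = (s : ZMod n) ∧ (a : ZMod n) = ((n / 2 : ℕ) : ZMod n))))) := by
  have : NeZero n := ⟨by omega⟩
  have ha0 := ZMod.natCast_ne_zero_of_mem_Ico ha
  have hb0 := ZMod.natCast_ne_zero_of_mem_Ico hb
  constructor
  · rintro ⟨hconn, hplanar⟩
    have hpl := planar_twoCirc_of_planar_Gamma hplanar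
    have hpl' := hpl
    rw [SimpleGraph.twoCirc_comm] at hpl'
    have hcop := gcd_eq_one_of_connected_Gamma hconn
    have hcop' : (n.gcd b).gcd a = 1 := by rw [← hcop, Nat.gcd_right_comm]
    by_cases hab : (a : ZMod n) = b ∨ (a : ZMod n) = -b
    · refine .inl ⟨hab, ?_⟩
      have hd : n.gcd a ∣ b := by
        have hdn := Nat.gcd_dvd_left n a
        rw [← ZMod.natCast_eq_zero_iff]
        have ha : ((a : ZMod n).cast : ZMod (n.gcd a)) = 0 := by
          rw [ZMod.cast_natCast hdn, ZMod.natCast_eq_zero_iff]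
          exact Nat.gcd_dvd_right n a
        rw [← ZMod.cast_natCast hdn]
        rcases hab with h | h
        · rwa [← h]
        · rw [← neg_eq_iff_eq_neg.2 h, ZMod.cast_neg hdn, ha, neg_zero]
      rwa [Nat.gcd_eq_left hd] at hcop
    push Not at hab
    have hba : (b : ZMod n) ≠ a ∧ (b : ZMod n) ≠ -a :=
      ⟨hab.1.symm, fun h => hab.2 (by rw [h, neg_neg])⟩
    by_cases h2b : 2 * (b : ZMod n) = 0
    · obtain ⟨h4, he, hg, hb⟩ := half_of_planar_twoCirc hn ha hb h2b hcop hpl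
      exact .inr (.inr ⟨h4, a, he, hg, .inl ⟨rfl, congrArg _ hb⟩⟩)
    by_cases h2a : 2 * (a : ZMod n) = 0
    · obtain ⟨h4, he, hg, ha⟩ := half_of_planar_twoCirc hn hb ha h2a hcop' hpl'
      exact .inr (.inr ⟨h4, b, he, hg, .inr ⟨rfl, congrArg _ ha⟩⟩)
    refine .inr (.inl ?_)
    have hda : n.gcd a < 3 := by
      by_contra h
      exact SimpleGraph.not_planar_twoCirc_of_three_le_gcd (by omega) a b (by omega) hcop
        ha0 hb0 h2a hpl
    have hdb : n.gcd b < 3 := by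
      by_contra h
      exact SimpleGraph.not_planar_twoCirc_of_three_le_gcd (by omega) b a (by omega) hcop'
        hb0 ha0 h2b hpl'
    have hda0 : 0 < n.gcd a := Nat.gcd_pos_of_pos_left _ (by omega)
    have hdb0 : 0 < n.gcd b := Nat.gcd_pos_of_pos_left _ (by omega)
    rcases (by omega : n.gcd a = 1 ∨ n.gcd b = 1 ∨ (n.gcd a = 2 ∧ n.gcd b = 2)) with h | h | h
    · obtain ⟨he, h2⟩ := ZMod.even_and_eq_two_mul_of_planar_twoCirc hn
        ((ZMod.isUnit_iff_coprime _ _).2 (Nat.Coprime.symm h)) hb0 hba.1 hba.2 h2b hpl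
      exact ⟨he, a, h, .inl ⟨rfl, h2⟩⟩
    · obtain ⟨he, h2⟩ := ZMod.even_and_eq_two_mul_of_planar_twoCirc hn
        ((ZMod.isUnit_iff_coprime _ _).2 (Nat.Coprime.symm h)) ha0 hab.1 hab.2 h2a hpl'
      exact ⟨he, b, h, .inr ⟨rfl, h2⟩⟩
    · have h2 : 2 ∣ (n.gcd a).gcd b :=
        Nat.dvd_gcd (h.1 ▸ dvd_rfl) (h.2 ▸ Nat.gcd_dvd_right n b)
      rw [hcop] at h2
      omega
  · rintro (⟨hab, hga⟩ | ⟨he, s, hs, h⟩ | ⟨h4, s, hse, hs, h⟩)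
    · have hu := (ZMod.isUnit_iff_coprime _ _).2 (Nat.Coprime.symm hga)
      refine ⟨connected_Gamma (.of_isUnit hu _), (isGammaDual_prism hu).planar (.inl rfl) ?_⟩
      rcases hab with h | h
      · exact .inl h.symm
      · exact .inr (by rw [h, neg_neg])
    · have hu : IsUnit (s : ZMod n) := (ZMod.isUnit_iff_coprime _ _).2 (Nat.Coprime.symm hs)
      have hdual := isGammaDual_two_mul hu (ZMod.castHom he.two_dvd (ZMod 2))
      rcases h with ⟨h₁, h₂⟩ | ⟨h₁, h₂⟩
      · exact ⟨connected_Gamma (.of_isUnit (h₁ ▸ hu) _), hdual.planar (.inl h₁) h₂⟩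
      · exact ⟨connected_Gamma (Generates.of_isUnit (h₁ ▸ hu) _).symm,
          hdual.symm.planar h₂ (.inl h₁)⟩
    · have h2n : 2 ∣ n := by omega
      have hgen : Generates (s : ZMod n) ((n / 2 : ℕ) : ZMod n) := by
        refine ⟨Nat.gcdB (n / 2) s, Nat.gcdA (n / 2) s, ?_⟩
        have := congrArg (Int.cast (R := ZMod n)) (Nat.gcd_eq_gcd_ab (n / 2) s)
        rw [hs, Int.cast_add, Int.cast_mul, Int.cast_mul, Int.cast_natCast, Int.cast_natCast,
          Int.cast_natCast, Nat.cast_one] at this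
        rw [this]
        ring
      have hm : ((n / 2 : ℕ) : ZMod n) + ((n / 2 : ℕ) : ZMod n) = 0 := by
        rw [← Nat.cast_add, ZMod.natCast_eq_zero_iff]
        exact ⟨1, by omega⟩
      have hdual := isGammaDual_half hgen hm (ZMod.castHom h2n (ZMod 2))
        (by rw [map_natCast, ZMod.natCast_eq_zero_iff]; exact hse.two_dvd)
        (by
          rw [map_natCast, ← Nat.cast_one, ZMod.natCast_eq_natCast_iff']
          omega) _ fun _ => rfl
      rcases h with ⟨h₁, h₂⟩ | ⟨h₁, h₂⟩
      · exact ⟨connected_Gamma (by rwa [h₁, h₂]), hdual.planar (.inl h₁) (.inl h₂)⟩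
      · exact ⟨connected_Gamma (by rw [h₁, h₂]; exact hgen.symm),
          hdual.symm.planar (.inl h₂) (.inl h₁)⟩
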